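/- Let (q_n)_{n≥1} be a sequence of reals with 0 < q_n < 1 for all n. If the sequence ([2]_{q_n}/[n−1]_{q_n})_{n≥3} = ((1+q_n)/[n−1]_{q_n})_{n≥3} is Abel null, then for every f ∈ C[0,1] the series Σ_{n=1}^∞ (D_n^{q_n}(f)(x) − f(x)) yⁿ converges for every x ∈ [0,1] and y ∈ (0,1), and lim_{y→1⁻} (1−y) · sup_{0≤x≤1} |Σ_{n=1}^∞ (D_n^{q_n}(f)(x) − f(x)) yⁿ| = 0. -/

import Mathlib

open Filter Topology

/-- The `q`-integer `[n]_q = 1 + q + ⋯ + q^{n-1}`. -/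
noncomputable def qInt (q : ℝ) (n : ℕ) : ℝ := ∑ k ∈ Finset.range n, q ^ k

/-- The `q`-factorial `[n]_q!`. -/
noncomputable def qFact (q : ℝ) (n : ℕ) : ℝ := ∏ k ∈ Finset.range n, qInt q (k + 1)

/-- The `q`-binomial coefficient `[m choose r]_q`. -/
noncomputable def qBinom (q : ℝ) (m r : ℕ) : ℝ := qFact q m / (qFact q r * qFact q (m - r))

/-- The Jackson `q`-integral of `g` over `[0,1]`. -/
noncomputable def qIntegral (q : ℝ) (g : ℝ → ℝ) : ℝ := (1 - q) * ∑' m : ℕ, q ^ m * g (q ^ m)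

/-- The `q`-shifted factorial `(t;q)_n`. -/
noncomputable def qShift (q t : ℝ) (n : ℕ) : ℝ := ∏ j ∈ Finset.range n, (1 - t * q ^ j)

/-- The `q`-beta function `B_q(m,n)`. -/
noncomputable def qBeta (q : ℝ) (m n : ℕ) : ℝ :=
  qIntegral q (fun t => t ^ (m - 1) * qShift q (q * t) (n - 1))

/-- The weight `m_{n,k,q}(x) = (x;q)_{n+1} [n+k choose k]_q x^k`. -/
noncomputable def mWeight (q : ℝ) (n k : ℕ) (x : ℝ) : ℝ :=
  qShift q x (n + 1) * qBinom q (n + k) k * x ^ k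

/-- The `q`-MKZ–Durrmeyer operator. -/
noncomputable def Durr (q : ℝ) (n : ℕ) (f : ℝ → ℝ) (x : ℝ) : ℝ :=
  if x = 1 then f 1
  else mWeight q n 0 x * f 0 +
    ∑' k : ℕ, mWeight q n (k + 1) x * (1 / qBeta q n (k + 1)) *
      qIntegral q (fun t => t ^ k * qShift q (q * t) (n - 1) * f t)

lemma qInt_add (q : ℝ) (m n : ℕ) : qInt q (m + n) = qInt q m + q ^ m * qInt q n := by
  simp only [qInt, Finset.sum_range_add, pow_add, Finset.mul_sum]

lemma one_le_qInt {q : ℝ} (hq : 0 < q) (n : ℕ) : 1 ≤ qInt q (n + 1) := by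
  rw [qInt, Finset.sum_range_succ']
  have : 0 ≤ ∑ k ∈ Finset.range n, q ^ (k + 1) := Finset.sum_nonneg fun _ _ => by positivity
  simpa using this

lemma qInt_pos {q : ℝ} (hq : 0 < q) (n : ℕ) : 0 < qInt q (n + 1) :=
  one_pos.trans_le (one_le_qInt hq n)

lemma qInt_zero (q : ℝ) : qInt q 0 = 0 := by simp [qInt]

lemma qInt_two (q : ℝ) : qInt q 2 = 1 + q := by simp [qInt, Finset.sum_range_succ]

lemma qInt_nonneg {q : ℝ} (hq : 0 < q) (n : ℕ) : 0 ≤ qInt q n :=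
  Finset.sum_nonneg fun _ _ => by positivity

lemma qInt_le_qInt_add {q : ℝ} (hq : 0 < q) (m n : ℕ) : qInt q m ≤ qInt q (m + n) := by
  rw [qInt_add]
  have := mul_nonneg (pow_nonneg hq.le m) (qInt_nonneg hq n)
  linarith

lemma qFact_succ (q : ℝ) (n : ℕ) : qFact q (n + 1) = qFact q n * qInt q (n + 1) :=
  Finset.prod_range_succ _ _

lemma qFact_pos {q : ℝ} (hq : 0 < q) (n : ℕ) : 0 < qFact q n :=
  Finset.prod_pos fun k _ => qInt_pos hq k

lemma qBinom_add_right (q : ℝ) (n k : ℕ) :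
    qBinom q (n + k) k = qFact q (n + k) / (qFact q k * qFact q n) := by
  rw [qBinom, Nat.add_sub_cancel]

lemma qBinom_add_nonneg {q : ℝ} (hq : 0 < q) (n k : ℕ) : 0 ≤ qBinom q (n + k) k := by
  rw [qBinom_add_right]
  have := qFact_pos hq
  exact div_nonneg (this _).le (mul_nonneg (this _).le (this _).le)

lemma qBinom_add_zero {q : ℝ} (hq : 0 < q) (n : ℕ) : qBinom q (n + 0) 0 = 1 := by
  have hn := (qFact_pos hq n).ne'
  rw [qBinom_add_right, add_zero, show qFact q 0 = 1 by simp [qFact], one_mul, div_self hn]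

/-- The `q`-Pascal rule. -/
lemma qBinom_pascal {q : ℝ} (hq : 0 < q) (n k : ℕ) :
    qBinom q (n + 1 + (k + 1)) (k + 1) =
      qBinom q (n + (k + 1)) (k + 1) + q ^ (n + 1) * qBinom q (n + 1 + k) k := by
  simp only [qBinom_add_right]
  rw [show n + 1 + (k + 1) = (n + k + 1) + 1 by ring, show n + (k + 1) = n + k + 1 by ring,
    show n + 1 + k = n + k + 1 by ring, qFact_succ q (n + k + 1), qFact_succ q k, qFact_succ q n,
    show n + k + 1 + 1 = (n + 1) + (k + 1) by ring, qInt_add q (n + 1) (k + 1)]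
  have h1 := (qFact_pos hq k).ne'
  have h2 := (qFact_pos hq n).ne'
  have h3 := (qInt_pos hq k).ne'
  have h4 := (qInt_pos hq n).ne'
  field_simp

lemma qShift_pos {q x : ℝ} (hq : 0 < q) (hq1 : q < 1) (hx0 : 0 ≤ x) (hx1 : x < 1) (n : ℕ) :
    0 < qShift q x n :=
  Finset.prod_pos fun j _ => by
    have : x * q ^ j ≤ x := mul_le_of_le_one_right hx0 (pow_le_one₀ hq.le hq1.le)
    linarith

/-- The `q`-binomial series. -/
lemma hasSum_qBinom {q x : ℝ} (hq : 0 < q) (hq1 : q < 1) (hx0 : 0 ≤ x) (hx1 : x < 1) (n : ℕ) :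
    HasSum (fun k => qBinom q (n + k) k * x ^ k) (qShift q x (n + 1))⁻¹ := by
  induction n with
  | zero =>
    have : (fun k => qBinom q (0 + k) k * x ^ k) = fun k => x ^ k := by
      funext k
      rw [qBinom_add_right, zero_add, show qFact q 0 = 1 by simp [qFact], mul_one,
        div_self (qFact_pos hq k).ne', one_mul]
    rw [this]
    simpa [qShift] using hasSum_geometric_of_lt_one hx0 hx1
  | succ n ih =>
    set r := x * q ^ (n + 1) with hr
    have hr0 : 0 ≤ r := by positivity
    have hr1 : r < 1 := by
      have : r ≤ x := mul_le_of_le_one_right hx0 (pow_le_one₀ hq.le hq1.le)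
      linarith
    set c : ℕ → ℝ := fun k => qBinom q (n + 1 + k) k * x ^ k with hc
    set d : ℕ → ℝ := fun k => qBinom q (n + k) k * x ^ k with hd
    have hc0 : c 0 = 1 := by simp only [hc, qBinom_add_zero hq, pow_zero, mul_one]
    have hd0 : d 0 = 1 := by simp only [hd, qBinom_add_zero hq, pow_zero, mul_one]
    have hcn : ∀ k, 0 ≤ c k := fun k =>
      mul_nonneg (qBinom_add_nonneg hq _ _) (pow_nonneg hx0 _)
    have hdn : ∀ k, 0 ≤ d k := fun k =>
      mul_nonneg (qBinom_add_nonneg hq _ _) (pow_nonneg hx0 _)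
    have hrec : ∀ k, c (k + 1) = d (k + 1) + r * c k := fun k => by
      simp only [hc, hd, hr, qBinom_pascal hq]
      ring
    have hpart : ∀ K, ∑ k ∈ Finset.range (K + 1), c k =
        ∑ k ∈ Finset.range (K + 1), d k + r * ∑ k ∈ Finset.range K, c k := fun K => by
      rw [Finset.sum_range_succ', Finset.sum_range_succ' d, hc0, hd0, Finset.mul_sum,
        Finset.sum_congr rfl fun k _ => hrec k, Finset.sum_add_distrib]
      ring
    have hsum : Summable c := by
      refine summable_of_sum_range_le (c := (qShift q x (n + 1))⁻¹ / (1 - r)) hcn fun K => ?_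
      rw [le_div_iff₀ (by linarith)]
      have h1 := hpart K
      rw [Finset.sum_range_succ c] at h1
      have h2 := sum_le_hasSum (Finset.range (K + 1)) (fun k _ => hdn k) ih
      have h3 := hcn K
      nlinarith
    have h1 := hsum.tsum_eq_zero_add
    have h2 := ih.summable.tsum_eq_zero_add
    rw [ih.tsum_eq, hd0] at h2
    have h3 : ∑' k, c (k + 1) = ∑' k, d (k + 1) + r * ∑' k, c k := by
      rw [tsum_congr hrec, Summable.tsum_add ((summable_nat_add_iff 1).2 ih.summable)
        (hsum.mul_left r), tsum_mul_left]
    have h4 : ∑' k, c k = (qShift q x (n + 1 + 1))⁻¹ := by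
      rw [qShift, Finset.prod_range_succ, mul_inv, ← div_eq_mul_inv, eq_div_iff (by linarith)]
      change _ = (qShift q x (n + 1))⁻¹
      linarith
    exact h4 ▸ hsum.hasSum

lemma mWeight_nonneg {q x : ℝ} (hq : 0 < q) (hq1 : q < 1) (hx0 : 0 ≤ x) (hx1 : x < 1) (n k : ℕ) :
    0 ≤ mWeight q n k x :=
  mul_nonneg (mul_nonneg (qShift_pos hq hq1 hx0 hx1 _).le (qBinom_add_nonneg hq _ _))
    (pow_nonneg hx0 _)

lemma hasSum_mWeight {q x : ℝ} (hq : 0 < q) (hq1 : q < 1) (hx0 : 0 ≤ x) (hx1 : x < 1) (n : ℕ) :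
    HasSum (fun k => mWeight q n k x) 1 := by
  have h := (hasSum_qBinom hq hq1 hx0 hx1 n).mul_left (qShift q x (n + 1))
  rw [mul_inv_cancel₀ (qShift_pos hq hq1 hx0 hx1 _).ne'] at h
  simpa only [mWeight, mul_assoc] using h

lemma mWeight_succ_mul {q : ℝ} (hq : 0 < q) (x : ℝ) (n k : ℕ) :
    mWeight q n (k + 1) x * (qInt q (k + 1) / qInt q (n + (k + 1))) = x * mWeight q n k x := by
  simp only [mWeight, qBinom_add_right]
  rw [show n + (k + 1) = (n + k) + 1 by ring, qFact_succ q (n + k), qFact_succ q k]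
  have h1 := (qFact_pos hq k).ne'
  have h2 := (qFact_pos hq n).ne'
  have h3 := (qInt_pos hq k).ne'
  have h4 := (qInt_pos hq (n + k)).ne'
  field_simp
  ring

lemma hasSum_mWeight_first_moment {q x : ℝ} (hq : 0 < q) (hq1 : q < 1) (hx0 : 0 ≤ x) (hx1 : x < 1)
    (n : ℕ) : HasSum (fun k => mWeight q n k x * (qInt q k / qInt q (n + k))) x := by
  rw [← hasSum_nat_add_iff' 1]
  simp only [mWeight_succ_mul hq, Finset.sum_range_one, qInt_zero, zero_div, mul_zero, sub_zero]
  simpa using (hasSum_mWeight hq hq1 hx0 hx1 n).mul_left x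

lemma qInt_ratio_le {q : ℝ} (hq : 0 < q) (hq1 : q < 1) (n k : ℕ) :
    qInt q (k + 2) / qInt q (n + 1 + (k + 2)) ≤
      qInt q k / qInt q (n + 1 + k) + (1 + q) / qInt q (n + 1) := by
  have hN := qInt_pos hq n
  have hA : 0 < qInt q (n + 1 + k) := hN.trans_le (qInt_le_qInt_add hq _ _)
  have hle : qInt q (n + 1) ≤ qInt q (n + 1 + k) := qInt_le_qInt_add hq _ _
  have hB : qInt q (n + 1) ≤ qInt q (n + 1 + (k + 2)) := qInt_le_qInt_add hq _ _
  have hBp := hN.trans_le hB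
  have e1 : qInt q (k + 2) = qInt q k + q ^ k * (1 + q) := by rw [qInt_add, qInt_two]
  have e2 : qInt q (n + 1 + (k + 2)) = qInt q (n + 1 + k) + q ^ (n + 1 + k) * (1 + q) := by
    rw [← add_assoc, qInt_add, qInt_two]
  have e3 : qInt q (n + 1 + k) = qInt q (n + 1) + q ^ (n + 1) * qInt q k := qInt_add _ _ _
  have key : qInt q (k + 2) / qInt q (n + 1 + (k + 2)) - qInt q k / qInt q (n + 1 + k) =
      q ^ k * (1 + q) * (qInt q (n + 1) / qInt q (n + 1 + k)) / qInt q (n + 1 + (k + 2)) := by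
    rw [eq_div_iff hBp.ne', sub_mul, div_mul_cancel₀ _ hBp.ne', e2, e1]
    rw [← mul_left_inj' hA.ne']
    field_simp
    rw [e3, pow_add]
    ring
  have h1 : q ^ k * (1 + q) * (qInt q (n + 1) / qInt q (n + 1 + k)) ≤ 1 + q := by
    have := (div_le_one hA).2 hle
    have h0 : 0 ≤ qInt q (n + 1) / qInt q (n + 1 + k) := by positivity
    have hk : q ^ k ≤ 1 := pow_le_one₀ hq.le hq1.le
    have : q ^ k * (qInt q (n + 1) / qInt q (n + 1 + k)) ≤ 1 := mul_le_one₀ hk h0 this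
    nlinarith
  have := div_le_div₀ (by positivity) h1 hN hB
  linarith

lemma hasSum_mWeight_second_moment {q x : ℝ} (hq : 0 < q) (hq1 : q < 1) (hx0 : 0 ≤ x)
    (hx1 : x < 1) (n : ℕ) :
    ∃ V ≤ x * (x + (1 + q) / qInt q (n + 1)),
      HasSum (fun k => mWeight q (n + 1) k x *
        (qInt q k / qInt q (n + 1 + k) * (qInt q (k + 1) / qInt q (n + 1 + (k + 1))))) V := by
  set w := fun k => mWeight q (n + 1) k x
  have hw : ∀ k, 0 ≤ w k := fun k => mWeight_nonneg hq hq1 hx0 hx1 _ _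
  have hg : HasSum (fun k => x * (w k * (qInt q k / qInt q (n + 1 + k)) +
      w k * ((1 + q) / qInt q (n + 1)))) (x * (x + 1 * ((1 + q) / qInt q (n + 1)))) :=
    ((hasSum_mWeight_first_moment hq hq1 hx0 hx1 (n + 1)).add
      ((hasSum_mWeight hq hq1 hx0 hx1 (n + 1)).mul_right _)).mul_left x
  set v := fun k => x * (w k * (qInt q (k + 2) / qInt q (n + 1 + (k + 2))))
  have hv0 : ∀ k, 0 ≤ v k := fun k =>
    mul_nonneg hx0 (mul_nonneg (hw k) (div_nonneg (qInt_nonneg hq _) (qInt_nonneg hq _)))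
  have hv : ∀ k, v k ≤ x * (w k * (qInt q k / qInt q (n + 1 + k)) +
      w k * ((1 + q) / qInt q (n + 1))) := fun k => by
    rw [← mul_add]
    exact mul_le_mul_of_nonneg_left
      (mul_le_mul_of_nonneg_left (qInt_ratio_le hq hq1 n k) (hw k)) hx0
  have hvs : Summable v := Summable.of_nonneg_of_le hv0 hv hg.summable
  refine ⟨∑' k, v k, ?_, ?_⟩
  · have := hasSum_le hv hvs.hasSum hg
    rwa [one_mul] at this
  · rw [← hasSum_nat_add_iff' 1]
    simp only [Finset.sum_range_one, qInt_zero, zero_div, mul_zero, zero_mul, sub_zero,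
      ← mul_assoc (mWeight _ _ _ _), mWeight_succ_mul hq]
    simpa only [v, w, mul_assoc, add_assoc, Nat.reduceAdd] using hvs.hasSum

lemma hasSum_of_hasSum_of_eq {f g : ℕ → ℝ} {a b : ℝ} (h : HasSum f a) (hfg : ∀ i, g i = f i)
    (hab : b = a) : HasSum g b := by
  rwa [hab, funext hfg]

/-- Moments of the `q`-beta weight. -/
lemma hasSum_qIntegral_beta {q : ℝ} (hq : 0 < q) (hq1 : q < 1) (n k : ℕ) :
    HasSum (fun m : ℕ => (1 - q) * (q ^ m * ((q ^ m) ^ k * qShift q (q * q ^ m) n)))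
      (qFact q k * qFact q n / qFact q (k + n + 1)) := by
  induction n generalizing k with
  | zero =>
    have hk : q ^ (k + 1) < 1 := pow_lt_one₀ hq.le hq1 (by simp)
    have h := (hasSum_geometric_of_lt_one (by positivity) hk).mul_left (1 - q)
    have h1 : qInt q (k + 1) = (1 - q ^ (k + 1)) / (1 - q) := by
      rw [qInt, geom_sum_eq hq1.ne, ← neg_sub 1, ← neg_sub 1 q, neg_div_neg_eq]
    refine hasSum_of_hasSum_of_eq h (fun m => ?_) ?_
    · simp only [qShift, Finset.range_zero, Finset.prod_empty, mul_one]
      ring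
    · have h2 := (qFact_pos hq k).ne'
      have h3 : 1 - q ≠ 0 := by linarith
      have h4 : 1 - q ^ (k + 1) ≠ 0 := by linarith
      rw [add_zero, qFact_succ, h1, show qFact q 0 = 1 by simp [qFact]]
      field_simp
  | succ n ih =>
    refine hasSum_of_hasSum_of_eq ((ih k).sub ((ih (k + 1)).mul_left (q ^ (n + 1))))
      (fun m => ?_) ?_
    · rw [qShift, Finset.prod_range_succ]
      simp only [qShift]
      ring
    · rw [show k + (n + 1) + 1 = k + n + 1 + 1 by ring, show k + 1 + n + 1 = k + n + 1 + 1 by ring,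
        qFact_succ q (k + n + 1), qFact_succ q k, qFact_succ q n,
        show k + n + 1 + 1 = (n + 1) + (k + 1) by ring, qInt_add q (n + 1) (k + 1)]
      have h1 := (qFact_pos hq (k + n + 1)).ne'
      have h2 : qInt q (n + 1) + q ^ (n + 1) * qInt q (k + 1) ≠ 0 := by
        rw [← qInt_add]
        exact (qInt_pos hq (n + 1 + k)).ne'
      field_simp
      ring

lemma qBeta_eq {q : ℝ} (hq : 0 < q) (hq1 : q < 1) (n k : ℕ) :
    qBeta q (n + 1) (k + 1) = qFact q k * qFact q n / qFact q (k + n + 1) := by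
  rw [qBeta, qIntegral, ← tsum_mul_left]
  simp only [Nat.add_sub_cancel]
  rw [(hasSum_qIntegral_beta hq hq1 k n).tsum_eq, mul_comm (qFact q n), add_comm n k]

lemma abs_tsum_mul_sub_le {w F b : ℕ → ℝ} {c W B : ℝ} (hw : ∀ i, 0 ≤ w i) (hW : HasSum w W)
    (hB : HasSum (fun i => w i * b i) B) (h : ∀ i, |F i - c| ≤ b i) :
    Summable (fun i => w i * F i) ∧ |∑' i, w i * F i - c * W| ≤ B := by
  have hbd : ∀ i, ‖w i * (F i - c)‖ ≤ w i * b i := fun i => by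
    rw [Real.norm_eq_abs, abs_mul, abs_of_nonneg (hw i)]
    exact mul_le_mul_of_nonneg_left (h i) (hw i)
  have hs : Summable (fun i => w i * (F i - c)) := Summable.of_norm_bounded hB.summable hbd
  have hF : HasSum (fun i => w i * F i) (∑' i, w i * (F i - c) + c * W) := by
    convert hs.hasSum.add (hW.mul_left c) using 2
    ring
  refine ⟨hF.summable, ?_⟩
  rw [hF.tsum_eq, add_sub_cancel_right]
  exact tsum_of_norm_bounded hB hbd

lemma abs_qIntegral_div_sub_le {q : ℝ} (hq : 0 < q) (hq1 : q < 1) (n k : ℕ) {f : ℝ → ℝ}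
    {x ε C : ℝ} (hf : ∀ t ∈ Set.Icc (0 : ℝ) 1, |f t - f x| ≤ ε + C * (t - x) ^ 2) :
    |1 / qBeta q (n + 1) (k + 1) *
        qIntegral q (fun t => t ^ k * qShift q (q * t) n * f t) - f x| ≤
      ε + C * (qInt q (k + 1) / qInt q (n + 1 + (k + 1)) *
          (qInt q (k + 2) / qInt q (n + 1 + (k + 2))) -
        2 * x * (qInt q (k + 1) / qInt q (n + 1 + (k + 1))) + x ^ 2) := by
  set β := qBeta q (n + 1) (k + 1) with hβ
  have hβe : β = qFact q k * qFact q n / qFact q (k + n + 1) := qBeta_eq hq hq1 n k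
  have hβ0 : 0 < β := by
    rw [hβe]
    have := qFact_pos hq
    exact div_pos (mul_pos (this _) (this _)) (this _)
  have e1 : qFact q (k + 1) * qFact q n / qFact q (k + 1 + n + 1) =
      β * (qInt q (k + 1) / qInt q (n + 1 + (k + 1))) := by
    rw [hβe, show k + 1 + n + 1 = k + n + 1 + 1 by ring, qFact_succ q k, qFact_succ q (k + n + 1),
      show n + 1 + (k + 1) = k + n + 1 + 1 by ring, div_mul_div_comm]
    ring
  have e2 : qFact q (k + 2) * qFact q n / qFact q (k + 2 + n + 1) =
      β * (qInt q (k + 1) / qInt q (n + 1 + (k + 1)) *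
          (qInt q (k + 2) / qInt q (n + 1 + (k + 2)))) := by
    rw [← mul_assoc, ← e1, show k + 2 + n + 1 = k + 1 + n + 1 + 1 by ring,
      qFact_succ q (k + 1), qFact_succ q (k + 1 + n + 1),
      show n + 1 + (k + 2) = k + 1 + n + 1 + 1 by ring, div_mul_div_comm]
    ring
  have s0 := hasSum_qIntegral_beta hq hq1 n k
  have s1 := hasSum_qIntegral_beta hq hq1 n (k + 1)
  have s2 := hasSum_qIntegral_beta hq hq1 n (k + 2)
  rw [← hβe] at s0
  rw [e1] at s1
  rw [e2] at s2
  set μ₁ := qInt q (k + 1) / qInt q (n + 1 + (k + 1))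
  set μ₂ := μ₁ * (qInt q (k + 2) / qInt q (n + 1 + (k + 2)))
  set w : ℕ → ℝ := fun m => (1 - q) * (q ^ m * ((q ^ m) ^ k * qShift q (q * q ^ m) n)) with hw
  have hqm : ∀ m, q ^ m ∈ Set.Icc (0 : ℝ) 1 := fun m => ⟨by positivity, pow_le_one₀ hq.le hq1.le⟩
  have hw0 : ∀ m, 0 ≤ w m := fun m => by
    have : 0 < qShift q (q * q ^ m) n :=
      qShift_pos hq hq1 (by positivity) (mul_lt_one_of_nonneg_of_lt_one_left hq.le hq1 (hqm m).2) n
    have : 0 ≤ 1 - q := by linarith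
    positivity
  have hB : HasSum (fun m => w m * (ε + C * (q ^ m - x) ^ 2))
      (β * (ε + C * (μ₂ - 2 * x * μ₁ + x ^ 2))) := by
    refine hasSum_of_hasSum_of_eq (((s0.mul_left ε).add ((s2.mul_left C).sub
      (s1.mul_left (2 * x * C)))).add (s0.mul_left (C * x ^ 2))) (fun m => ?_) ?_
    · simp only [hw]
      ring
    · ring
  have := (abs_tsum_mul_sub_le hw0 s0 hB fun m => hf _ (hqm m)).2
  have hI : qIntegral q (fun t => t ^ k * qShift q (q * t) n * f t) = ∑' m, w m * f (q ^ m) := by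
    rw [qIntegral, ← tsum_mul_left]
    refine tsum_congr fun m => ?_
    simp only [hw]
    ring
  rw [hI]
  set I := ∑' m, w m * f (q ^ m)
  rw [show 1 / β * I - f x = (I - f x * β) / β by field_simp, abs_div, abs_of_pos hβ0,
    div_le_iff₀ hβ0]
  linarith

/-- A quantitative Korovkin estimate for the `q`-MKZ–Durrmeyer operator. -/
lemma abs_Durr_sub_le {q : ℝ} (hq : 0 < q) (hq1 : q < 1) (n : ℕ) {f : ℝ → ℝ} {x ε C : ℝ}
    (hx : x ∈ Set.Icc (0 : ℝ) 1) (hε : 0 ≤ ε) (hC : 0 ≤ C)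
    (hf : ∀ t ∈ Set.Icc (0 : ℝ) 1, |f t - f x| ≤ ε + C * (t - x) ^ 2) :
    |Durr q (n + 1) f x - f x| ≤ ε + C * ((1 + q) / qInt q (n + 1)) := by
  have hr : 0 ≤ (1 + q) / qInt q (n + 1) := div_nonneg (by linarith) (qInt_nonneg hq _)
  by_cases hx1 : x = 1
  · simp only [Durr, hx1, if_true, sub_self, abs_zero]
    positivity
  have hx1 : x < 1 := lt_of_le_of_ne hx.2 hx1
  have hx0 := hx.1
  have s0 := hasSum_mWeight hq hq1 hx0 hx1 (n + 1)
  have s1 := hasSum_mWeight_first_moment hq hq1 hx0 hx1 (n + 1)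
  obtain ⟨V, hV, s2⟩ := hasSum_mWeight_second_moment hq hq1 hx0 hx1 n
  set F : ℕ → ℝ := fun k => Nat.casesOn k (f 0) fun k => 1 / qBeta q (n + 1) (k + 1) *
        qIntegral q (fun t => t ^ k * qShift q (q * t) n * f t) with hF
  set b : ℕ → ℝ := fun k => ε + C * (qInt q k / qInt q (n + 1 + k) *
          (qInt q (k + 1) / qInt q (n + 1 + (k + 1))) -
        2 * x * (qInt q k / qInt q (n + 1 + k)) + x ^ 2) with hb
  have hFb : ∀ k, |F k - f x| ≤ b k := by
    intro k
    cases k with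
    | zero => simpa [hF, hb, qInt_zero] using hf 0 (by simp)
    | succ k => exact abs_qIntegral_div_sub_le hq hq1 n k hf
  have hB : HasSum (fun k => mWeight q (n + 1) k x * b k)
      (ε + C * (V - x ^ 2)) := by
    refine hasSum_of_hasSum_of_eq (((s0.mul_left ε).add ((s2.mul_left C).sub
      (s1.mul_left (2 * x * C)))).add (s0.mul_left (C * x ^ 2))) (fun m => ?_) ?_
    · simp only [hb]
      ring
    · ring
  obtain ⟨hs, hle⟩ := abs_tsum_mul_sub_le (fun k => mWeight_nonneg hq hq1 hx0 hx1 (n + 1) k)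
    s0 hB hFb
  have hD : Durr q (n + 1) f x = ∑' k, mWeight q (n + 1) k x * F k := by
    rw [Durr, if_neg hx1.ne, hs.tsum_eq_zero_add]
    simp only [hF, Nat.add_sub_cancel, mul_assoc]
    rfl
  rw [hD]
  rw [mul_one] at hle
  refine hle.trans ?_
  gcongr
  nlinarith

lemma exists_abs_sub_le_add_mul_sq {f : ℝ → ℝ} (hf : ContinuousOn f (Set.Icc 0 1)) {ε : ℝ}
    (hε : 0 < ε) : ∃ C : ℝ, 0 ≤ C ∧ ∀ x ∈ Set.Icc (0 : ℝ) 1, ∀ t ∈ Set.Icc (0 : ℝ) 1,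
      |f t - f x| ≤ ε + C * (t - x) ^ 2 := by
  obtain ⟨M, hM⟩ := isCompact_Icc.exists_bound_of_continuousOn hf
  have hM0 : 0 ≤ M := (norm_nonneg _).trans (hM 0 (by simp))
  have huc := isCompact_Icc.uniformContinuousOn_of_continuous hf
  obtain ⟨δ, hδ, h⟩ := Metric.uniformContinuousOn_iff.1 huc ε hε
  refine ⟨2 * M / δ ^ 2, by positivity, fun x hx t ht => ?_⟩
  rcases lt_or_ge (dist t x) δ with hlt | hge
  · have h1 := h t ht x hx hlt
    rw [Real.dist_eq] at h1
    have : 0 ≤ 2 * M / δ ^ 2 * (t - x) ^ 2 := by positivity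
    linarith
  · have h1 : |f t - f x| ≤ 2 * M := by
      have := abs_sub (f t) (f x)
      have h1 := hM t ht
      have h2 := hM x hx
      rw [Real.norm_eq_abs] at h1 h2
      linarith
    have h2 : δ ^ 2 ≤ (t - x) ^ 2 := by
      rw [← sq_abs (t - x)]
      exact pow_le_pow_left₀ hδ.le hge 2
    have h3 : 2 * M ≤ 2 * M / δ ^ 2 * (t - x) ^ 2 := by
      rw [div_mul_eq_mul_div, le_div_iff₀ (by positivity)]
      gcongr
    linarith

theorem stmt9 (q : ℕ → ℝ) (hq : ∀ n : ℕ, 1 ≤ n → 0 < q n ∧ q n < 1)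
    -- the sequence `([2]_{q_n}/[n-1]_{q_n})_{n ≥ 3} = ((1+q_n)/[n-1]_{q_n})_{n ≥ 3}` is Abel null
    (habel :
      (∀ y ∈ Set.Ioo (0 : ℝ) 1,
        Summable (fun n : ℕ => ((1 + q (n + 3)) / qInt (q (n + 3)) (n + 2)) * y ^ (n + 3))) ∧
      Tendsto
        (fun y : ℝ => (1 - y) * ∑' n : ℕ, ((1 + q (n + 3)) / qInt (q (n + 3)) (n + 2)) * y ^ (n + 3))
        (𝓝[<] 1) (𝓝 0))
    (f : ℝ → ℝ) (hf : ContinuousOn f (Set.Icc 0 1)) :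
    (∀ y ∈ Set.Ioo (0 : ℝ) 1, ∀ x ∈ Set.Icc (0 : ℝ) 1,
      Summable (fun n : ℕ => (Durr (q (n + 1)) (n + 1) f x - f x) * y ^ (n + 1))) ∧
    Tendsto (fun y : ℝ =>
        (1 - y) * ⨆ x : Set.Icc (0 : ℝ) 1,
          |∑' n : ℕ, (Durr (q (n + 1)) (n + 1) f x - f x) * y ^ (n + 1)|)
      (𝓝[<] 1) (𝓝 0) := by
  have hr : ∀ n, (1 + q (n + 1)) / qInt (q (n + 1)) (n + 1) ≤ 2 := fun n => by
    obtain ⟨h0, h1⟩ := hq (n + 1) (by omega)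
    rw [div_le_iff₀ (qInt_pos h0 n)]
    linarith [one_le_qInt h0 n]
  have hD : ∀ ε > 0, ∃ C : ℝ, 0 ≤ C ∧ ∀ n, ∀ x ∈ Set.Icc (0 : ℝ) 1,
      |Durr (q (n + 1)) (n + 1) f x - f x| ≤
        ε + C * ((1 + q (n + 1)) / qInt (q (n + 1)) (n + 1)) := fun ε hε => by
    obtain ⟨C, hC, h⟩ := exists_abs_sub_le_add_mul_sq hf hε
    refine ⟨C, hC, fun n x hx => ?_⟩
    obtain ⟨h0, h1⟩ := hq (n + 1) (by omega)
    exact abs_Durr_sub_le h0 h1 n hx hε.le hC (h x hx)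
  have hgeo : ∀ y ∈ Set.Ioo (0 : ℝ) 1, HasSum (fun n : ℕ => y ^ (n + 1)) (y / (1 - y)) :=
    fun y hy => by
      simpa only [pow_succ', div_eq_mul_inv] using
        (hasSum_geometric_of_lt_one hy.1.le hy.2).mul_left y
  constructor
  · intro y hy x hx
    obtain ⟨C, hC, h⟩ := hD 1 one_pos
    refine Summable.of_norm_bounded ((hgeo y hy).summable.mul_left (1 + C * 2)) fun n => ?_
    have hy0 := hy.1
    rw [norm_mul, Real.norm_eq_abs, Real.norm_of_nonneg (by positivity)]
    gcongr
    exact (h n x hx).trans (by gcongr; exact hr n)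
  · rw [Metric.tendsto_nhds]
    intro ε hε
    obtain ⟨C, hC, h⟩ := hD (ε / 2) (half_pos hε)
    set A : ℝ → ℝ := fun y =>
      ∑' n : ℕ, ((1 + q (n + 3)) / qInt (q (n + 3)) (n + 2)) * y ^ (n + 3) with hA
    have hlim : Tendsto (fun y : ℝ => ε / 2 + C * ((1 - y) * 4 + (1 - y) * A y)) (𝓝[<] 1)
        (𝓝 (ε / 2 + C * ((1 - 1) * 4 + 0))) := by
      refine tendsto_const_nhds.add (Tendsto.const_mul C (Tendsto.add ?_ habel.2))
      exact ((tendsto_const_nhds.sub tendsto_id).mul_const 4).mono_left nhdsWithin_le_nhds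
    have hev := hlim.eventually_lt_const (u := ε) (by linarith)
    filter_upwards [hev, Ioo_mem_nhdsLT (zero_lt_one' ℝ)] with y hlt hy
    have hy0 := hy.1
    have hy1 : 0 < 1 - y := by linarith [hy.2]
    rw [dist_zero_right, Real.norm_of_nonneg
      (mul_nonneg hy1.le (Real.iSup_nonneg fun _ => abs_nonneg _))]
    refine lt_of_le_of_lt ?_ hlt
    set a : ℕ → ℝ := fun n => (1 + q (n + 1)) / qInt (q (n + 1)) (n + 1) * y ^ (n + 1) with ha
    have haA : ∀ n, a (n + 2) ≤ ((1 + q (n + 3)) / qInt (q (n + 3)) (n + 2)) * y ^ (n + 3) :=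
      fun n => by
        have h0 := (hq (n + 3) (by omega)).1
        have := qInt_pos h0 (n + 1)
        have hle : qInt (q (n + 3)) (n + 2) ≤ qInt (q (n + 3)) (n + 3) :=
          qInt_le_qInt_add h0 (n + 2) 1
        simp only [ha]
        gcongr
    have ha0 : ∀ n, 0 ≤ a n := fun n => by
      have h0 := (hq (n + 1) (by omega)).1
      have := qInt_pos h0 n
      positivity
    have ha2 : ∀ n, a n ≤ 2 := fun n => by
      calc a n ≤ 2 * 1 := mul_le_mul (hr n) (pow_le_one₀ hy0.le hy.2.le) (by positivity) two_pos.le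
        _ = 2 := mul_one 2
    have hs2 : Summable fun n => a (n + 2) :=
      Summable.of_nonneg_of_le (fun n => ha0 _) haA (habel.1 y hy)
    have hs : Summable a := (summable_nat_add_iff 2).1 hs2
    have hale : ∑' n, a n ≤ 4 + A y := by
      rw [← hs.sum_add_tsum_nat_add 2, Finset.sum_range_succ, Finset.sum_range_one]
      have := hs2.tsum_le_tsum haA (habel.1 y hy)
      linarith [ha2 0, ha2 1]
    have hsup : (⨆ x : Set.Icc (0 : ℝ) 1,
        |∑' n : ℕ, (Durr (q (n + 1)) (n + 1) f x - f x) * y ^ (n + 1)|) ≤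
          ε / 2 * (y / (1 - y)) + C * ∑' n, a n := by
      refine ciSup_le fun x => ?_
      rw [← Real.norm_eq_abs]
      refine tsum_of_norm_bounded (((hgeo y hy).mul_left (ε / 2)).add (hs.hasSum.mul_left C))
        fun n => ?_
      rw [norm_mul, Real.norm_eq_abs, Real.norm_of_nonneg (pow_nonneg hy0.le _)]
      simp only [ha]
      rw [← mul_assoc, ← add_mul]
      gcongr
      exact h n x x.2
    calc _ ≤ (1 - y) * (ε / 2 * (y / (1 - y)) + C * (4 + A y)) := by
          gcongr
          exact hsup.trans (by gcongr)
      _ = ε / 2 * y + C * ((1 - y) * 4 + (1 - y) * A y) := by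
          field_simp
      _ ≤ _ := by
          gcongr
          exact mul_le_of_le_one_right (half_pos hε).le hy.2.le
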